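/- Let K be a field of characteristic zero, let l be a natural number, and let T ∈ K with T ≠ 1. Then there exists a polynomial Q ∈ K[X] of degree at most l such that for every natural number m: Σ_{k=0}^{m−1} k^l · T^k = Q(m) · T^m − Q(0). -/

import Mathlib

/-- For `T ≠ 1`, the twisted difference equation `T * Q(x + 1) - Q(x) = x ^ l` has a polynomial
solution of degree at most `l`. -/
theorem exists_polynomial_twisted_difference_eq_pow {K : Type*} [Field K] {T : K} (hT : T ≠ 1)
    (l : ℕ) :
    ∃ Q : Polynomial K, Q.degree ≤ (l : WithBot ℕ) ∧
      ∀ x : K, T * Q.eval (x + 1) - Q.eval x = x ^ l := by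
  induction l using Nat.strong_induction_on with
  | _ l ih =>
    have ih' : ∀ i : ℕ, ∃ Q : Polynomial K, i < l → Q.degree ≤ (i : WithBot ℕ) ∧
        ∀ x : K, T * Q.eval (x + 1) - Q.eval x = x ^ i := fun i => by
      by_cases hi : i < l
      · obtain ⟨Q, hQ⟩ := ih i hi
        exact ⟨Q, fun _ => hQ⟩
      · exact ⟨0, fun h => absurd h hi⟩
    choose q hq using ih'
    refine ⟨(T - 1)⁻¹ • (Polynomial.X ^ l -
      T • ∑ i ∈ Finset.range l, (l.choose i : K) • q i), ?_, fun x => ?_⟩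
    · simp only [← Polynomial.mem_degreeLE]
      refine Submodule.smul_mem _ _ (Submodule.sub_mem _ ?_ (Submodule.smul_mem _ _
        (Submodule.sum_mem _ fun i hi => Submodule.smul_mem _ _ ?_)))
      · exact Polynomial.mem_degreeLE.2 (Polynomial.degree_X_pow_le l)
      · have hil := Finset.mem_range.1 hi
        exact Polynomial.mem_degreeLE.2 ((hq i hil).1.trans (by exact_mod_cast hil.le))
    · have hsum : T * ∑ i ∈ Finset.range l, (l.choose i : K) * (q i).eval (x + 1) -
          ∑ i ∈ Finset.range l, (l.choose i : K) * (q i).eval x =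
          ∑ i ∈ Finset.range l, x ^ i * (l.choose i : K) := by
        rw [Finset.mul_sum, ← Finset.sum_sub_distrib]
        refine Finset.sum_congr rfl fun i hi => ?_
        rw [← (hq i (Finset.mem_range.1 hi)).2 x]
        ring
      have hbinom : (x + 1) ^ l = ∑ i ∈ Finset.range l, x ^ i * (l.choose i : K) + x ^ l := by
        simp [add_pow, Finset.sum_range_succ]
      have hT' : T - 1 ≠ 0 := sub_ne_zero.2 hT
      simp only [Polynomial.eval_smul, Polynomial.eval_sub, Polynomial.eval_pow,
        Polynomial.eval_X, Polynomial.eval_finsetSum, smul_eq_mul]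
      field_simp
      linear_combination T * hbinom - T * hsum


/-- closed form for geometrically weighted power sums
`Σ_{k=0}^{m-1} k^l T^k = Q(m)·T^m - Q(0)` with `Q` a polynomial of degree at most `l`,
for `T ≠ 1` in a field of characteristic zero. -/
theorem geometric_power_sum_closed_form (K : Type*) [Field K] [CharZero K]
    (l : ℕ) (T : K) (hT : T ≠ 1) :
    ∃ Q : Polynomial K, Q.degree ≤ (l : WithBot ℕ) ∧
      ∀ m : ℕ, ∑ k ∈ Finset.range m, (k : K) ^ l * T ^ k =
        Polynomial.eval (m : K) Q * T ^ m - Polynomial.eval 0 Q := by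
  obtain ⟨Q, hdeg, hQ⟩ := exists_polynomial_twisted_difference_eq_pow hT l
  refine ⟨Q, hdeg, fun m => ?_⟩
  induction m with
  | zero => simp
  | succ m ih =>
    rw [Finset.sum_range_succ, ih, ← hQ m]
    push_cast
    ring
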